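/- The scramble number of the rook graph K_4 □ K_4 equals 11, which is strictly smaller than its gonality gon(K_4 □ K_4) = 12. -/

import Mathlib

/-- Decidability of adjacency in a box product of simple graphs. -/
instance {α β : Type*} (G : SimpleGraph α) (H : SimpleGraph β) [DecidableEq α] [DecidableEq β]
    [DecidableRel G.Adj] [DecidableRel H.Adj] : DecidableRel (G □ H).Adj := fun _ _ =>
  decidable_of_iff _ SimpleGraph.boxProd_adj.symm

/-- The degree of a divisor: the sum of its values. -/
def degD {V : Type*} [Fintype V] (D : V → ℤ) : ℤ := ∑ v, D v

/-- A divisor is effective if all its values are nonnegative. -/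
def Effective {V : Type*} (D : V → ℤ) : Prop := ∀ v, 0 ≤ D v

/-- The number of edges from the vertex `v` to the vertex set `A`. -/
def edgesTo {V : Type*} [DecidableEq V] (G : SimpleGraph V) [DecidableRel G.Adj]
    (v : V) (A : Finset V) : ℕ := (A.filter (fun u => G.Adj v u)).card

/-- The divisor obtained from `D` by firing the vertex subset `A`: every vertex of `A`
sends one chip along each edge leaving `A`. -/
def fire {V : Type*} [Fintype V] [DecidableEq V] (G : SimpleGraph V) [DecidableRel G.Adj]
    (D : V → ℤ) (A : Finset V) : V → ℤ :=
  fun v => if v ∈ A then D v - edgesTo G v Aᶜ else D v + edgesTo G v A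

/-- Two divisors are equivalent if one is obtained from the other by a finite
sequence of subset firings. -/
def LinEquiv {V : Type*} [Fintype V] [DecidableEq V] (G : SimpleGraph V) [DecidableRel G.Adj]
    (D D' : V → ℤ) : Prop :=
  Relation.ReflTransGen (fun D₁ D₂ => ∃ A : Finset V, D₂ = fire G D₁ A) D D'

/-- A divisor `D` has rank at least `r` if for every effective divisor `E` of degree `r`,
`D - E` is equivalent to an effective divisor. -/
def RankGE {V : Type*} [Fintype V] [DecidableEq V] (G : SimpleGraph V) [DecidableRel G.Adj]
    (D : V → ℤ) (r : ℕ) : Prop :=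
  ∀ E : V → ℤ, Effective E → degD E = (r : ℤ) →
    ∃ D', LinEquiv G (D - E) D' ∧ Effective D'

/-- The `k`-gonality of a graph: the minimal degree of a divisor of rank at least `k`. -/
noncomputable def kGonality {V : Type*} [Fintype V] [DecidableEq V] (G : SimpleGraph V)
    [DecidableRel G.Adj] (k : ℕ) : ℕ :=
  sInf {d : ℕ | ∃ D : V → ℤ, RankGE G D k ∧ degD D = (d : ℤ)}

/-- The gonality of a graph: the minimal degree of a divisor of rank at least `1`. -/
noncomputable def gonality {V : Type*} [Fintype V] [DecidableEq V] (G : SimpleGraph V)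
    [DecidableRel G.Adj] : ℕ := kGonality G 1

/-- The two-dimensional rook graph `K_n □ K_m`: the box product of the complete graphs
on `n` and `m` vertices. -/
def rook (n m : ℕ) : SimpleGraph (Fin n × Fin m) :=
  (⊤ : SimpleGraph (Fin n)) □ (⊤ : SimpleGraph (Fin m))

instance (n m : ℕ) : DecidableRel (rook n m).Adj := by unfold rook; infer_instance

/-- A scramble on `G`: a collection of nonempty vertex subsets (eggs), each of which
induces a connected subgraph. -/
def IsScramble {V : Type*} (G : SimpleGraph V) (S : Set (Finset V)) : Prop :=
  ∀ E ∈ S, E.Nonempty ∧ (G.induce (E : Set V)).Connected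

/-- A hitting set of a scramble: a vertex set intersecting every egg. -/
def IsHittingSet {V : Type*} [DecidableEq V] (S : Set (Finset V)) (H : Finset V) : Prop :=
  ∀ E ∈ S, (E ∩ H).Nonempty

/-- The number of edges with one endpoint in `X` and the other outside `X`. -/
def cutSize {V : Type*} [Fintype V] [DecidableEq V] (G : SimpleGraph V) [DecidableRel G.Adj]
    (X : Finset V) : ℕ :=
  (Finset.univ.filter (fun p : V × V => G.Adj p.1 p.2 ∧ p.1 ∈ X ∧ p.2 ∉ X)).card

/-- The partition `(X, Xᶜ)` is an egg cut of `S` if some egg is contained in `X` and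
some egg is contained in `Xᶜ`. -/
def IsEggCut {V : Type*} [Fintype V] [DecidableEq V] (S : Set (Finset V)) (X : Finset V) : Prop :=
  (∃ E ∈ S, E ⊆ X) ∧ (∃ E ∈ S, E ⊆ Xᶜ)

/-- The order of a scramble: the minimum of the minimal hitting set size and the minimal
egg cut-set size (`⊤` if no hitting set/egg cut exists). -/
noncomputable def scrambleOrder {V : Type*} [Fintype V] [DecidableEq V] (G : SimpleGraph V)
    [DecidableRel G.Adj] (S : Set (Finset V)) : ℕ∞ :=
  min (sInf {k : ℕ∞ | ∃ H : Finset V, IsHittingSet S H ∧ (H.card : ℕ∞) = k})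
      (sInf {k : ℕ∞ | ∃ X : Finset V, IsEggCut S X ∧ (cutSize G X : ℕ∞) = k})

/-- The scramble number of a graph: the maximum order of a scramble on it. -/
noncomputable def scrambleNumber {V : Type*} [Fintype V] [DecidableEq V] (G : SimpleGraph V)
    [DecidableRel G.Adj] : ℕ∞ :=
  sSup {k : ℕ∞ | ∃ S : Set (Finset V), IsScramble G S ∧ scrambleOrder G S = k}

section Laplacian

variable {V : Type*} [Fintype V] (G : SimpleGraph V) [DecidableRel G.Adj]

/-- The graph Laplacian applied to an integer-valued function. -/
def lap (f : V → ℤ) (v : V) : ℤ := ∑ u, if G.Adj v u then f v - f u else 0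

theorem lap_add (f g : V → ℤ) : lap G (f + g) = lap G f + lap G g := by
  funext v
  simp only [lap, Pi.add_apply, ← Finset.sum_add_distrib]
  refine Finset.sum_congr rfl fun u _ => ?_
  split_ifs <;> ring

theorem lap_zero : lap G 0 = 0 := by
  funext v
  simp [lap]

theorem lap_sub (f g : V → ℤ) : lap G (f - g) = lap G f - lap G g := by
  have h := lap_add G (f - g) g
  rw [sub_add_cancel] at h
  rw [h, add_sub_cancel_right]

theorem sum_lap (f : V → ℤ) : ∑ v, lap G f v = 0 := by
  have h : ∑ v, lap G f v = -∑ v, lap G f v := by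
    simp only [lap]
    conv_lhs => rw [Finset.sum_comm]
    simp only [← Finset.sum_neg_distrib]
    refine Finset.sum_congr rfl fun u _ => Finset.sum_congr rfl fun v _ => ?_
    simp only [G.adj_comm v u]
    split_ifs <;> ring
  omega

theorem degD_sub_lap (D f : V → ℤ) : degD (D - lap G f) = degD D := by
  simp [degD, Finset.sum_sub_distrib, sum_lap]

variable [DecidableEq V]

/-- The integer-valued indicator function of a vertex set. -/
def ind {V : Type*} [DecidableEq V] (A : Finset V) (v : V) : ℤ := if v ∈ A then 1 else 0

theorem edgesTo_eq_sum (v : V) (A : Finset V) :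
    (edgesTo G v A : ℤ) = ∑ u, if G.Adj v u then ind A u else 0 := by
  rw [edgesTo, Finset.card_filter, Nat.cast_sum]
  refine Finset.sum_subset_zero_on_sdiff (Finset.subset_univ A) (fun u hu => ?_) fun u hu => ?_
  · simp [ind, (Finset.mem_sdiff.1 hu).2]
  · simp [ind, hu]

theorem fire_eq_sub_lap (D : V → ℤ) (A : Finset V) : fire G D A = D - lap G (ind A) := by
  funext v
  simp only [fire, edgesTo_eq_sum, lap, Pi.sub_apply]
  by_cases hv : v ∈ A
  · rw [if_pos hv]
    congr 1
    refine Finset.sum_congr rfl fun u _ => ?_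
    by_cases hu : u ∈ A <;> simp [ind, hv, hu]
  · rw [if_neg hv, sub_eq_add_neg, ← Finset.sum_neg_distrib]
    congr 1
    refine Finset.sum_congr rfl fun u _ => ?_
    by_cases hu : u ∈ A <;> by_cases ha : G.Adj v u <;> simp [ind, hv, hu, ha]

theorem LinEquiv.exists_lap {D D' : V → ℤ} (h : LinEquiv G D D') :
    ∃ f : V → ℤ, D' = D - lap G f := by
  induction h with
  | refl => exact ⟨0, by rw [lap_zero, sub_zero]⟩
  | tail _ hs ih =>
    obtain ⟨f, rfl⟩ := ih
    obtain ⟨A, rfl⟩ := hs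
    exact ⟨f + ind A, by rw [fire_eq_sub_lap, lap_add, sub_sub]⟩

/-- If `D` is `q`-reduced and has no chip on `q`, then no effective divisor equivalent to `D`
has a chip on `q`. -/
theorem sub_lap_apply_nonpos_of_reduced {D f : V → ℤ} {q : V} (hq : D q = 0)
    (hred : ∀ A : Finset V, A.Nonempty → q ∉ A → ∃ v ∈ A, D v < edgesTo G v Aᶜ)
    (heff : Effective (D - lap G f)) : (D - lap G f) q ≤ 0 := by
  obtain ⟨m, -, hm⟩ := Finset.exists_max_image Finset.univ f ⟨q, Finset.mem_univ q⟩
  have hm' : ∀ u, f u ≤ f m := fun u => hm u (Finset.mem_univ u)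
  by_cases hqm : f q = f m
  · have : 0 ≤ lap G f q := by
      refine Finset.sum_nonneg fun u _ => ?_
      split_ifs
      · have := hm' u
        omega
      · exact le_rfl
    simp only [Pi.sub_apply]
    omega
  · obtain ⟨v, hvA, hv⟩ := hred (Finset.univ.filter fun u => f u = f m) ⟨m, by simp⟩
      (by simpa using hqm)
    have hvm : f v = f m := by simpa using hvA
    have hle : (edgesTo G v (Finset.univ.filter fun u => f u = f m)ᶜ : ℤ) ≤ lap G f v := by
      rw [edgesTo_eq_sum]
      refine Finset.sum_le_sum fun u _ => ?_
      have := hm' u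
      by_cases ha : G.Adj v u <;> by_cases hu : f u = f m <;> simp [ind, ha, hu] <;> omega
    have := heff v
    simp only [Pi.sub_apply] at this
    omega

theorem cutSize_eq_sum_edgesTo (X : Finset V) : cutSize G X = ∑ v ∈ X, edgesTo G v Xᶜ := by
  have h : cutSize G X = ((X ×ˢ Xᶜ).filter fun p => G.Adj p.1 p.2).card := by
    unfold cutSize
    congr 1
    ext p
    simp
    tauto
  rw [h, Finset.card_filter, Finset.sum_product]
  simp only [edgesTo, Finset.card_filter]

theorem cutSize_compl (X : Finset V) : cutSize G Xᶜ = cutSize G X := by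
  refine Finset.card_bij (fun p _ => p.swap) ?_ ?_ ?_
  · intro p hp
    simp only [Finset.mem_filter, Finset.mem_univ, true_and, Finset.mem_compl, not_not] at hp
    simp [hp.1.symm, hp.2.1, hp.2.2]
  · intro p _ p' _ h
    exact Prod.swap_injective h
  · intro p hp
    simp only [Finset.mem_filter, Finset.mem_univ, true_and] at hp
    exact ⟨p.swap, by simp [hp.1.symm, hp.2.1, hp.2.2], by simp⟩

/-- Firing `A` strictly decreases the sum of squares of `D` when the Laplacian of the indicator
of `A` is bounded below by `c` times that indicator, minus `k`. -/
theorem sum_sq_sub_lap_lt {D : V → ℤ} (hD : Effective D) (A : Finset V) (c k : ℤ)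
    (hL : ∀ u, c * ind A u - k ≤ lap G (ind A) u)
    (h : ∑ u, lap G (ind A) u ^ 2 < 2 * (c * ∑ u ∈ A, D u - k * degD D)) :
    ∑ u, (D - lap G (ind A)) u ^ 2 < ∑ u, D u ^ 2 := by
  have h1 : c * ∑ u ∈ A, D u - k * degD D ≤ ∑ u, D u * lap G (ind A) u := by
    have : c * ∑ u ∈ A, D u - k * degD D = ∑ u, D u * (c * ind A u - k) := by
      simp only [mul_sub, Finset.sum_sub_distrib, degD, Finset.mul_sum, ind]
      congr 1
      · refine Finset.sum_subset_zero_on_sdiff (Finset.subset_univ A) (fun u hu => ?_)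
          fun u hu => ?_
        · simp [(Finset.mem_sdiff.1 hu).2]
        · simp [hu, mul_comm]
      · exact Finset.sum_congr rfl fun u _ => mul_comm _ _
    rw [this]
    exact Finset.sum_le_sum fun u _ => mul_le_mul_of_nonneg_left (hL u) (hD u)
  have h2 : ∑ u, (D - lap G (ind A)) u ^ 2 =
      ∑ u, D u ^ 2 - 2 * ∑ u, D u * lap G (ind A) u + ∑ u, lap G (ind A) u ^ 2 := by
    rw [Finset.mul_sum, ← Finset.sum_sub_distrib, ← Finset.sum_add_distrib]
    refine Finset.sum_congr rfl fun u _ => ?_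
    simp only [Pi.sub_apply]
    ring
  omega

end Laplacian

section Rook

theorem rook_adj {n m : ℕ} (p q : Fin n × Fin m) :
    (rook n m).Adj p q ↔ (p.1 = q.1 ∧ p.2 ≠ q.2) ∨ (p.2 = q.2 ∧ p.1 ≠ q.1) := by
  simp only [rook, SimpleGraph.boxProd_adj, SimpleGraph.top_adj]
  tauto

theorem cutSize_rook {n m : ℕ} (X : Finset (Fin n × Fin m)) :
    cutSize (rook n m) X =
      (∑ i, (Finset.univ.filter fun p : Fin m × Fin m => (i, p.1) ∈ X ∧ (i, p.2) ∉ X).card) +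
      ∑ j, (Finset.univ.filter fun p : Fin n × Fin n => (p.1, j) ∈ X ∧ (p.2, j) ∉ X).card := by
  have key : ∀ (i : Fin n) (a : Fin m) (i' : Fin n) (b : Fin m),
      (if (rook n m).Adj (i, a) (i', b) ∧ (i, a) ∈ X ∧ (i', b) ∉ X then 1 else 0) =
      (if i = i' then (if (i, a) ∈ X ∧ (i', b) ∉ X then 1 else 0) else 0) +
      (if a = b then (if (i, a) ∈ X ∧ (i', b) ∉ X then 1 else 0) else 0) := by
    intro i a i' b
    by_cases h1 : i = i' <;> by_cases h2 : a = b <;> simp [rook_adj, h1, h2]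
  simp only [cutSize, Finset.card_filter, Fintype.sum_prod_type, key, Finset.sum_add_distrib]
  congr 1
  · refine Finset.sum_congr rfl fun i _ => Finset.sum_congr rfl fun a _ => ?_
    rw [Finset.sum_comm]
    simp
  · rw [Finset.sum_comm]
    refine Finset.sum_congr rfl fun j _ => Finset.sum_congr rfl fun i _ => ?_
    simp

theorem three_le_card_cut_fin_four : ∀ s : Finset (Fin 4), s.Nonempty → s ≠ Finset.univ →
    3 ≤ (Finset.univ.filter fun p : Fin 4 × Fin 4 => p.1 ∈ s ∧ p.2 ∉ s).card := by
  decide +kernel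

theorem three_le_row_cut {X : Finset (Fin 4 × Fin 4)} {i a b : Fin 4}
    (ha : (i, a) ∈ X) (hb : (i, b) ∉ X) :
    3 ≤ (Finset.univ.filter
      fun p : Fin 4 × Fin 4 => (i, p.1) ∈ X ∧ (i, p.2) ∉ X).card := by
  have := three_le_card_cut_fin_four (Finset.univ.filter fun a => (i, a) ∈ X) ⟨a, by simpa⟩
    fun h => hb (by simpa using (Finset.ext_iff.1 h b))
  simpa using this

theorem three_le_col_cut {X : Finset (Fin 4 × Fin 4)} {j a b : Fin 4}
    (ha : (a, j) ∈ X) (hb : (b, j) ∉ X) :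
    3 ≤ (Finset.univ.filter
      fun p : Fin 4 × Fin 4 => (p.1, j) ∈ X ∧ (p.2, j) ∉ X).card := by
  have := three_le_card_cut_fin_four (Finset.univ.filter fun a => (a, j) ∈ X) ⟨a, by simpa⟩
    fun h => hb (by simpa using (Finset.ext_iff.1 h b))
  simpa using this

/-- A set of at most two vertices, any two of which are adjacent. -/
def SmallClique (X : Finset (Fin 4 × Fin 4)) : Prop :=
  X.card ≤ 2 ∧ ∀ u ∈ X, ∀ v ∈ X, u ≠ v → (rook 4 4).Adj u v

theorem smallClique_of_empty_lines {X : Finset (Fin 4 × Fin 4)} {i j : Fin 4}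
    (hi : ∀ a, (i, a) ∉ X) (hj : ∀ a, (a, j) ∉ X) (hcut : cutSize (rook 4 4) X ≤ 11) :
    SmallClique X := by
  have hR : 3 * (X.image Prod.fst).card ≤
      ∑ i, (Finset.univ.filter
        fun p : Fin 4 × Fin 4 => (i, p.1) ∈ X ∧ (i, p.2) ∉ X).card := by
    rw [mul_comm, ← smul_eq_mul]
    refine (Finset.card_nsmul_le_sum _ _ 3 fun r hr => ?_).trans
      (Finset.sum_le_sum_of_subset (Finset.subset_univ _))
    obtain ⟨⟨r, a⟩, hp, rfl⟩ := Finset.mem_image.1 hr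
    exact three_le_row_cut hp (hj r)
  have hC : 3 * (X.image Prod.snd).card ≤
      ∑ j, (Finset.univ.filter
        fun p : Fin 4 × Fin 4 => (p.1, j) ∈ X ∧ (p.2, j) ∉ X).card := by
    rw [mul_comm, ← smul_eq_mul]
    refine (Finset.card_nsmul_le_sum _ _ 3 fun r hr => ?_).trans
      (Finset.sum_le_sum_of_subset (Finset.subset_univ _))
    obtain ⟨⟨a, r⟩, hp, rfl⟩ := Finset.mem_image.1 hr
    exact three_le_col_cut hp (hi r)
  rw [cutSize_rook] at hcut
  have hsum : (X.image Prod.fst).card + (X.image Prod.snd).card ≤ 3 := by omega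
  have hX : X.card ≤ (X.image Prod.fst).card * (X.image Prod.snd).card := by
    rw [← Finset.card_product]
    exact Finset.card_le_card Finset.subset_product
  generalize hr : (X.image Prod.fst).card = r at *
  generalize hc : (X.image Prod.snd).card = c at *
  refine ⟨?_, fun u hu v hv huv => ?_⟩
  · have : r ≤ 3 := by omega
    have : c ≤ 3 := by omega
    interval_cases r <;> interval_cases c <;> omega
  · have h1 : r ≤ 1 ∨ c ≤ 1 := by omega
    rw [rook_adj]
    rcases h1 with h1 | h1
    · have := Finset.card_le_one.1 (hr.trans_le h1) u.1 (Finset.mem_image_of_mem _ hu) v.1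
        (Finset.mem_image_of_mem _ hv)
      exact Or.inl ⟨this, fun h => huv (Prod.ext this h)⟩
    · have := Finset.card_le_one.1 (hc.trans_le h1) u.2 (Finset.mem_image_of_mem _ hu) v.2
        (Finset.mem_image_of_mem _ hv)
      exact Or.inr ⟨this, fun h => huv (Prod.ext h this)⟩

/-- The only edge cuts of `K_4 □ K_4` with at most `11` edges separate a clique of at most two
vertices from the rest. -/
theorem smallClique_of_cutSize_le {X : Finset (Fin 4 × Fin 4)}
    (hcut : cutSize (rook 4 4) X ≤ 11) : SmallClique X ∨ SmallClique Xᶜ := by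
  have hrow : ∃ i, ∀ a b, (i, a) ∈ X → (i, b) ∈ X := by
    by_contra! h
    have : ∑ _i : Fin 4, 3 ≤ ∑ i, (Finset.univ.filter
        fun p : Fin 4 × Fin 4 => (i, p.1) ∈ X ∧ (i, p.2) ∉ X).card :=
      Finset.sum_le_sum fun i _ => by
        obtain ⟨a, b, ha, hb⟩ := h i
        exact three_le_row_cut ha hb
    rw [cutSize_rook] at hcut
    simp only [Finset.sum_const, Finset.card_univ, Fintype.card_fin, smul_eq_mul] at this
    omega
  have hcol : ∃ j, ∀ a b, (a, j) ∈ X → (b, j) ∈ X := by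
    by_contra! h
    have : ∑ _j : Fin 4, 3 ≤ ∑ j, (Finset.univ.filter
        fun p : Fin 4 × Fin 4 => (p.1, j) ∈ X ∧ (p.2, j) ∉ X).card :=
      Finset.sum_le_sum fun j _ => by
        obtain ⟨a, b, ha, hb⟩ := h j
        exact three_le_col_cut ha hb
    rw [cutSize_rook] at hcut
    simp only [Finset.sum_const, Finset.card_univ, Fintype.card_fin, smul_eq_mul] at this
    omega
  obtain ⟨i, hi⟩ := hrow
  obtain ⟨j, hj⟩ := hcol
  by_cases hij : (i, j) ∈ X
  · right
    rw [← cutSize_compl] at hcut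
    exact smallClique_of_empty_lines (i := i) (j := j)
      (fun a => by simpa using hi j a hij) (fun a => by simpa using hj i a hij) hcut
  · left
    exact smallClique_of_empty_lines (i := i) (j := j)
      (fun a h => hij (hi a j h)) (fun a h => hij (hj a i h)) hcut

theorem SmallClique.eq {X : Finset (Fin 4 × Fin 4)} (h : SmallClique X) (hne : X.Nonempty) :
    (∃ v, X = {v}) ∨ ∃ u v, (rook 4 4).Adj u v ∧ X = {u, v} := by
  have := hne.card_pos
  have h2 := h.1
  obtain h1 | h1 : X.card = 1 ∨ X.card = 2 := by omega
  · exact Or.inl (Finset.card_eq_one.1 h1)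
  · obtain ⟨u, v, huv, rfl⟩ := Finset.card_eq_two.1 h1
    exact Or.inr ⟨u, v, h.2 u (by simp) v (by simp) huv, rfl⟩

end Rook

section ScrambleNumber

/-- A set of six vertices contains a vertex and two of its neighbours. -/
theorem exists_cherry {U : Finset (Fin 4 × Fin 4)} (hU : 6 ≤ U.card) :
    ∃ q ∈ U, ∃ y ∈ U, ∃ z ∈ U, (rook 4 4).Adj q y ∧ (rook 4 4).Adj q z ∧ y ≠ z := by
  by_contra! hno
  have hfib : ∀ π : Fin 4 × Fin 4 → Fin 4,
      ∑ p ∈ U, (3 - ((U.filter fun u => π u = π p).card : ℤ)) ≤ 8 := by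
    intro π
    rw [← Finset.sum_fiberwise U π]
    have : ∀ i ∈ (Finset.univ : Finset (Fin 4)), ∑ p ∈ U.filter (fun u => π u = i),
        (3 - ((U.filter fun u => π u = π p).card : ℤ)) ≤ 2 := by
      intro i _
      have h : ∑ p ∈ U.filter (fun u => π u = i), (3 - ((U.filter fun u => π u = π p).card : ℤ))
          = ∑ p ∈ U.filter (fun u => π u = i), (3 - ((U.filter fun u => π u = i).card : ℤ)) :=
        Finset.sum_congr rfl fun p hp => by rw [(Finset.mem_filter.1 hp).2]
      rw [h, Finset.sum_const, nsmul_eq_mul]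
      generalize (U.filter fun u => π u = i).card = n
      rcases (show n ≤ 1 ∨ 2 ≤ n by omega) with h | h
      · interval_cases n <;> norm_num
      · zify at h
        nlinarith
    exact (Finset.sum_le_sum this).trans (by simp)
  have hpt : ∀ p ∈ U, 3 ≤ (3 - ((U.filter fun u => u.1 = p.1).card : ℤ)) +
      (3 - ((U.filter fun u => u.2 = p.2).card : ℤ)) := by
    intro p hp
    have hN : (U.filter fun u => (rook 4 4).Adj p u).card ≤ 1 := by
      refine Finset.card_le_one.2 fun y hy z hz => ?_
      rw [Finset.mem_filter] at hy hz
      exact hno p hp y hy.1 z hz.1 hy.2 hz.2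
    have h1 : (U.filter fun u => (rook 4 4).Adj p u) =
        ((U.filter fun u => u.1 = p.1).erase p) ∪ ((U.filter fun u => u.2 = p.2).erase p) := by
      ext u
      simp only [rook_adj, Finset.mem_filter, Finset.mem_union, Finset.mem_erase, Prod.ext_iff,
        ne_eq, eq_comm (a := p.1), eq_comm (a := p.2)]
      tauto
    have h2 : Disjoint ((U.filter fun u => u.1 = p.1).erase p)
        ((U.filter fun u => u.2 = p.2).erase p) := by
      rw [Finset.disjoint_left]
      simp only [Finset.mem_filter, Finset.mem_erase, Prod.ext_iff, ne_eq]
      tauto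
    rw [h1, Finset.card_union_of_disjoint h2, Finset.card_erase_of_mem (by simp [hp]),
      Finset.card_erase_of_mem (by simp [hp])] at hN
    omega
  have h := Finset.sum_le_sum hpt
  rw [Finset.sum_add_distrib, Finset.sum_const, nsmul_eq_mul] at h
  have h1 := hfib Prod.fst
  have h2 := hfib Prod.snd
  omega

/-- The scramble of all paths on three vertices, including those with adjacent ends. -/
def cherries : Set (Finset (Fin 4 × Fin 4)) :=
  {E | ∃ q y z, (rook 4 4).Adj q y ∧ (rook 4 4).Adj q z ∧ y ≠ z ∧ E = {q, y, z}}

theorem isScramble_cherries : IsScramble (rook 4 4) cherries := by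
  rintro E ⟨q, y, z, hy, hz, -, rfl⟩
  refine ⟨⟨q, by simp⟩, ?_⟩
  rw [SimpleGraph.connected_iff_exists_forall_reachable]
  refine ⟨⟨q, by simp⟩, ?_⟩
  rintro ⟨w, hw⟩
  simp only [Finset.coe_insert, Finset.coe_singleton, Set.mem_insert_iff,
    Set.mem_singleton_iff] at hw
  rcases hw with rfl | rfl | rfl
  · exact SimpleGraph.Reachable.refl _
  · exact SimpleGraph.Adj.reachable (by simpa using hy)
  · exact SimpleGraph.Adj.reachable (by simpa using hz)

theorem card_of_mem_cherries {E : Finset (Fin 4 × Fin 4)} (h : E ∈ cherries) : E.card = 3 := by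
  obtain ⟨q, y, z, hy, hz, hyz, rfl⟩ := h
  exact Finset.card_eq_three.2 ⟨q, y, z, hy.ne, hz.ne, hyz, rfl⟩

theorem eleven_le_scrambleOrder_cherries : 11 ≤ scrambleOrder (rook 4 4) cherries := by
  refine le_min (le_sInf ?_) (le_sInf ?_)
  · rintro _ ⟨H, hH, rfl⟩
    by_contra! hlt
    have hlt' : H.card < 11 := by exact_mod_cast hlt
    obtain ⟨q, hq, y, hy, z, hz, hqy, hqz, hyz⟩ := exists_cherry (U := Hᶜ) (by
      rw [Finset.card_compl]
      simp only [Fintype.card_prod, Fintype.card_fin]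
      omega)
    obtain ⟨w, hw⟩ := hH {q, y, z} ⟨q, y, z, hqy, hqz, hyz, rfl⟩
    simp only [Finset.mem_inter, Finset.mem_insert, Finset.mem_singleton,
      Finset.mem_compl] at hw hq hy hz
    rcases hw with ⟨rfl | rfl | rfl, h⟩ <;> contradiction
  · rintro _ ⟨X, ⟨⟨E, hE, hEX⟩, ⟨F, hF, hFX⟩⟩, rfl⟩
    by_contra! hlt
    have hlt' : cutSize (rook 4 4) X < 11 := by exact_mod_cast hlt
    have h1 := Finset.card_le_card hEX
    have h2 := Finset.card_le_card hFX
    rw [card_of_mem_cherries hE] at h1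
    rw [card_of_mem_cherries hF] at h2
    rcases smallClique_of_cutSize_le hlt'.le with h | h <;> have := h.1 <;> omega

theorem const_of_connected_induce {V α : Type*} {G : SimpleGraph V} {s : Set V}
    (h : (G.induce s).Connected) (c : V → α)
    (hc : ∀ u ∈ s, ∀ v ∈ s, G.Adj u v → c u = c v) {u v : V} (hu : u ∈ s) (hv : v ∈ s) :
    c u = c v := by
  obtain ⟨w⟩ := h.preconnected ⟨u, hu⟩ ⟨v, hv⟩
  have key : ∀ {a b : s}, (G.induce s).Walk a b → c a = c b := by
    intro a b w
    induction w with
    | nil => rfl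
    | cons hadj _ ih => exact (hc _ (Subtype.coe_prop _) _ (Subtype.coe_prop _) hadj).trans ih
  exact key w

/-- Two disjoint edges and a vertex of `K_4 □ K_4`, pairwise non-adjacent; indexed by `Fin 3`. -/
def sparseParts : Fin 3 → Finset (Fin 4 × Fin 4) :=
  ![{(0, 0), (0, 1)}, {(1, 2), (2, 2)}, {(3, 3)}]

/-- The index of the member of `sparseParts` that contains a vertex of their union. -/
def sparseIndex (p : Fin 4 × Fin 4) : Fin 3 := ![0, 1, 1, 2] p.1

theorem exists_subset_sparseParts {E : Finset (Fin 4 × Fin 4)}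
    (hE : E.Nonempty) (hconn : ((rook 4 4).induce (E : Set (Fin 4 × Fin 4))).Connected)
    (hsub : E ⊆ Finset.univ.biUnion sparseParts) : ∃ k, E ⊆ sparseParts k := by
  obtain ⟨u, hu⟩ := hE
  have hadj : ∀ u ∈ Finset.univ.biUnion sparseParts, ∀ v ∈ Finset.univ.biUnion sparseParts,
      (rook 4 4).Adj u v → sparseIndex u = sparseIndex v := by decide +kernel
  have hmem : ∀ v ∈ Finset.univ.biUnion sparseParts, v ∈ sparseParts (sparseIndex v) := by
    decide +kernel
  refine ⟨sparseIndex u, fun v hv => ?_⟩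
  rw [const_of_connected_induce hconn sparseIndex
    (fun a ha b hb => hadj a (hsub ha) b (hsub hb)) hu hv]
  exact hmem v (hsub hv)

theorem scrambleOrder_le_eleven {S : Set (Finset (Fin 4 × Fin 4))}
    (hS : IsScramble (rook 4 4) S) : scrambleOrder (rook 4 4) S ≤ 11 := by
  by_contra! hlt
  obtain ⟨hhit, hcut⟩ := lt_min_iff.1 hlt
  have hhit' : ∀ H : Finset (Fin 4 × Fin 4), IsHittingSet S H → 11 < H.card := fun H hH => by
    exact_mod_cast hhit.trans_le (sInf_le ⟨H, hH, rfl⟩)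
  have hcut' : ∀ X : Finset (Fin 4 × Fin 4), IsEggCut S X → 11 < cutSize (rook 4 4) X :=
    fun X hX => by exact_mod_cast hcut.trans_le (sInf_le ⟨X, hX, rfl⟩)
  obtain ⟨E, hES, hE⟩ : ∃ E ∈ S, ¬ (E ∩ (Finset.univ.biUnion sparseParts)ᶜ).Nonempty := by
    by_contra! h
    have h1 := hhit' _ h
    have h2 : ((Finset.univ.biUnion sparseParts)ᶜ).card = 11 := by decide +kernel
    omega
  have hsub : E ⊆ Finset.univ.biUnion sparseParts := by
    intro v hv
    by_contra hv'
    exact hE ⟨v, Finset.mem_inter.2 ⟨hv, Finset.mem_compl.2 hv'⟩⟩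
  obtain ⟨k, hk⟩ := exists_subset_sparseParts (hS E hES).1 (hS E hES).2 hsub
  by_cases hF : ∃ F ∈ S, F ⊆ (sparseParts k)ᶜ
  · have h1 := hcut' _ ⟨⟨E, hES, hk⟩, hF⟩
    have h2 : ∀ k, cutSize (rook 4 4) (sparseParts k) ≤ 11 := by decide +kernel
    exact absurd h1 (h2 k).not_gt
  · push Not at hF
    have h1 := hhit' (sparseParts k) fun F hFS => by
      obtain ⟨v, hv, hv'⟩ := Finset.not_subset.1 (hF F hFS)
      exact ⟨v, Finset.mem_inter.2 ⟨hv, by simpa using hv'⟩⟩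
    have h2 : ∀ k, (sparseParts k).card ≤ 11 := by decide +kernel
    exact absurd h1 (h2 k).not_gt

theorem scrambleNumber_rook : scrambleNumber (rook 4 4) = 11 := by
  refine le_antisymm (sSup_le ?_)
    (eleven_le_scrambleOrder_cherries.trans (le_sSup ⟨_, isScramble_cherries, rfl⟩))
  rintro _ ⟨S, hS, rfl⟩
  exact scrambleOrder_le_eleven hS

end ScrambleNumber

section Gonality

theorem Effective.le_degD {V : Type*} [Fintype V] {D : V → ℤ} (hD : Effective D)
    (A : Finset V) : ∑ v ∈ A, D v ≤ degD D :=
  Finset.sum_le_sum_of_subset_of_nonneg (Finset.subset_univ A) fun v _ _ => hD v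

theorem Effective.eq_single {V : Type*} [Fintype V] [DecidableEq V] {E : V → ℤ}
    (hE : Effective E) (hdeg : degD E = 1) : ∃ q, E = Pi.single q 1 := by
  obtain ⟨q, -, hq⟩ : ∃ q ∈ Finset.univ, E q ≠ 0 :=
    Finset.exists_ne_zero_of_sum_ne_zero (by rw [← degD, hdeg]; exact one_ne_zero)
  have hq' := hE q
  refine ⟨q, funext fun v => ?_⟩
  by_cases hv : v = q
  · subst hv
    have := hE.le_degD {v}
    rw [Finset.sum_singleton] at this
    rw [Pi.single_eq_same]
    omega
  · have := hE.le_degD {q, v}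
    rw [Finset.sum_pair (Ne.symm hv)] at this
    have := hE v
    rw [Pi.single_eq_of_ne hv]
    omega

/-- A legal firing of a clique of at most two vertices in an effective divisor of degree at most
`11` strictly decreases the sum of squares. -/
theorem sum_sq_sub_lap_lt_of_smallClique {D : Fin 4 × Fin 4 → ℤ} (hD : Effective D)
    (hdeg : degD D ≤ 11) {A : Finset (Fin 4 × Fin 4)} (hA : SmallClique A) (hne : A.Nonempty)
    (hlegal : ∀ v ∈ A, (edgesTo (rook 4 4) v Aᶜ : ℤ) ≤ D v) :
    ∑ u, (D - lap (rook 4 4) (ind A)) u ^ 2 < ∑ u, D u ^ 2 := by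
  rcases hA.eq hne with ⟨v, rfl⟩ | ⟨a, b, hab, rfl⟩
  · have h1 : ∀ v, edgesTo (rook 4 4) v {v}ᶜ = 6 := by decide +kernel
    have h2 : ∀ v u, 7 * ind {v} u - 1 ≤ lap (rook 4 4) (ind {v}) u := by decide +kernel
    have h3 : ∀ v, ∑ u, lap (rook 4 4) (ind {v}) u ^ 2 = 42 := by decide +kernel
    have h4 := hlegal v (by simp)
    rw [h1] at h4
    refine sum_sq_sub_lap_lt _ hD _ 7 1 (h2 v) ?_
    rw [h3, Finset.sum_singleton]
    push_cast at h4
    omega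
  · have h1 : ∀ a b, (rook 4 4).Adj a b → edgesTo (rook 4 4) a {a, b}ᶜ = 5 ∧
        edgesTo (rook 4 4) b {a, b}ᶜ = 5 := by decide +kernel
    have h2 : ∀ a b, (rook 4 4).Adj a b →
        ∀ u, 7 * ind {a, b} u - 2 ≤ lap (rook 4 4) (ind {a, b}) u := by decide +kernel
    have h3 : ∀ a b, (rook 4 4).Adj a b → ∑ u, lap (rook 4 4) (ind {a, b}) u ^ 2 = 64 := by
      decide +kernel
    have h4 := hlegal a (by simp)
    have h5 := hlegal b (by simp)
    rw [(h1 a b hab).1] at h4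
    rw [(h1 a b hab).2] at h5
    refine sum_sq_sub_lap_lt _ hD _ 7 2 (h2 a b hab) ?_
    rw [h3 a b hab, Finset.sum_pair hab.ne]
    push_cast at h4 h5
    omega

theorem exists_adj_of_four_lt_card {Z : Finset (Fin 4 × Fin 4)} (hZ : 4 < Z.card) :
    ∃ q ∈ Z, ∃ w ∈ Z, (rook 4 4).Adj q w := by
  obtain ⟨q, hq, w, hw, hne, h⟩ := Finset.exists_ne_map_eq_of_card_lt_of_maps_to
    (s := Z) (t := Finset.univ) (f := Prod.fst) (by simpa using hZ) (fun _ _ => by simp)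
  exact ⟨q, hq, w, hw, (rook_adj q w).2 (Or.inl ⟨h, fun h' => hne (Prod.ext h h')⟩)⟩

theorem edgesTo_pos {V : Type*} [DecidableEq V] {G : SimpleGraph V} [DecidableRel G.Adj]
    {u v : V} {A : Finset V} (hv : v ∈ A) (h : G.Adj u v) : 0 < edgesTo G u A :=
  Finset.card_pos.2 ⟨v, Finset.mem_filter.2 ⟨hv, h⟩⟩

/-- The vertex `v` is distinct from `x`, outside `{q, w}` and not adjacent to `q` or `w`. -/
def FreeOf (q w x v : Fin 4 × Fin 4) : Prop :=
  v ∉ ({q, w} : Finset (Fin 4 × Fin 4)) ∧ v ≠ x ∧ edgesTo (rook 4 4) v {q, w} = 0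

instance (q w x : Fin 4 × Fin 4) : DecidablePred (FreeOf q w x) := fun v => by
  unfold FreeOf
  infer_instance

/-- Some empty vertex `q` of an effective divisor of degree at most `11` lies in no clique of at
most two vertices whose complement can be legally fired. -/
theorem exists_zero_not_legal {D : Fin 4 × Fin 4 → ℤ} (hD : Effective D) (hdeg : degD D ≤ 11) :
    ∃ q, D q = 0 ∧ ∀ B : Finset (Fin 4 × Fin 4), q ∈ B → B.card ≤ 2 →
      ∃ v ∉ B, D v < edgesTo (rook 4 4) v B := by
  have hZ : 4 < (Finset.univ.filter fun v => D v = 0).card := by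
    have h1 := Finset.card_filter_add_card_filter_not
      (s := (Finset.univ : Finset (Fin 4 × Fin 4))) (fun v => D v = 0)
    have h2 : ((Finset.univ.filter fun v => ¬ D v = 0).card : ℤ) ≤ degD D := by
      refine le_trans ?_ (hD.le_degD (Finset.univ.filter fun v => ¬ D v = 0))
      rw [Finset.card_eq_sum_ones]
      push_cast
      refine Finset.sum_le_sum fun v hv => ?_
      have := hD v
      have := (Finset.mem_filter.1 hv).2
      omega
    simp only [Finset.card_univ, Fintype.card_prod, Fintype.card_fin] at h1
    omega
  obtain ⟨q, hq, w, hw, hqw⟩ := exists_adj_of_four_lt_card hZ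
  replace hq : D q = 0 := (Finset.mem_filter.1 hq).2
  replace hw : D w = 0 := (Finset.mem_filter.1 hw).2
  by_cases hlegal : ∀ v ∉ ({q, w} : Finset (Fin 4 × Fin 4)),
      (edgesTo (rook 4 4) v {q, w} : ℤ) ≤ D v
  · obtain ⟨x, hx⟩ : ∃ x, ∀ v, v ∉ ({q, w} : Finset (Fin 4 × Fin 4)) → v ≠ x →
        D v = edgesTo (rook 4 4) v {q, w} := by
      by_contra! h
      obtain ⟨x, hxm, -, hx⟩ := h q
      obtain ⟨y, hym, hyx, hy⟩ := h x
      have hsum : ∀ q w, (rook 4 4).Adj q w →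
          ∑ v ∈ ({q, w} : Finset (Fin 4 × Fin 4))ᶜ, (edgesTo (rook 4 4) v {q, w} : ℤ) = 10 := by
        decide +kernel
      have h1 : ∑ v ∈ ({q, w} : Finset (Fin 4 × Fin 4))ᶜ,
          (D v - (edgesTo (rook 4 4) v {q, w} : ℤ)) ≤ 1 := by
        rw [Finset.sum_sub_distrib, hsum q w hqw]
        have := hD.le_degD {q, w}ᶜ
        omega
      have h2 : ∑ v ∈ {x, y}, (D v - (edgesTo (rook 4 4) v {q, w} : ℤ)) ≤
          ∑ v ∈ ({q, w} : Finset (Fin 4 × Fin 4))ᶜ,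
            (D v - (edgesTo (rook 4 4) v {q, w} : ℤ)) := by
        refine Finset.sum_le_sum_of_subset_of_nonneg ?_ fun v hv _ => ?_
        · intro v hv
          rw [Finset.mem_insert, Finset.mem_singleton] at hv
          rcases hv with rfl | rfl <;> rwa [Finset.mem_compl]
        · have := hlegal v (Finset.mem_compl.1 hv)
          omega
      rw [Finset.sum_pair hyx.symm] at h2
      have := hlegal x hxm
      have := hlegal y hym
      omega
    have hcfg : ∀ q w, (rook 4 4).Adj q w → ∀ x, ∃ r, FreeOf q w x r ∧
        ∃ y, (rook 4 4).Adj r y ∧ FreeOf q w x y ∧ ∃ z, (rook 4 4).Adj r z ∧ y ≠ z ∧ FreeOf q w x z := by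
      decide +kernel
    obtain ⟨r, hr, y, hry, hy, z, hrz, hyz, hz⟩ := hcfg q w hqw x
    have hzero : ∀ v, FreeOf q w x v → D v = 0 := fun v ⟨h1, h2, h3⟩ => by
      rw [hx v h1 h2, h3, Nat.cast_zero]
    refine ⟨r, hzero r hr, fun B hB hcard => ?_⟩
    have hout : y ∉ B ∨ z ∉ B := by
      by_contra! h
      have := Finset.card_le_card (s := {r, y, z}) (t := B) (by
        simp [Finset.insert_subset_iff, hB, h.1, h.2])
      rw [Finset.card_eq_three.2 ⟨r, y, z, hry.ne, hrz.ne, hyz, rfl⟩] at this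
      omega
    rcases hout with h | h
    · refine ⟨y, h, ?_⟩
      rw [hzero y hy]
      exact_mod_cast edgesTo_pos hB hry.symm
    · refine ⟨z, h, ?_⟩
      rw [hzero z hz]
      exact_mod_cast edgesTo_pos hB hrz.symm
  · push Not at hlegal
    refine ⟨q, hq, fun B hB hcard => ?_⟩
    by_cases hwB : w ∈ B
    · have : ({q, w} : Finset (Fin 4 × Fin 4)) = B :=
        Finset.eq_of_subset_of_card_le (by simp [Finset.insert_subset_iff, hB, hwB])
          (by rwa [Finset.card_pair hqw.ne])
      rwa [← this]
    · refine ⟨w, hwB, ?_⟩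
      rw [hw]
      exact_mod_cast edgesTo_pos hB hqw.symm

theorem not_rankGE_one_of_degD_le {D : Fin 4 × Fin 4 → ℤ} (hdeg : degD D ≤ 11) :
    ¬ RankGE (rook 4 4) D 1 := by
  intro hrank
  have hreach : ∀ q, ∃ f, Effective (D - lap (rook 4 4) f) ∧
      1 ≤ (D - lap (rook 4 4) f) q := by
    intro q
    obtain ⟨D', hD', heff⟩ := hrank (Pi.single q 1)
      (fun v => by by_cases h : v = q <;> simp [h])
      (by simp [degD])
    obtain ⟨f, rfl⟩ := hD'.exists_lap
    refine ⟨f, fun v => ?_, ?_⟩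
    · have h1 := heff v
      have h2 : (0 : ℤ) ≤ (Pi.single q 1 : Fin 4 × Fin 4 → ℤ) v := by
        by_cases h : v = q <;> simp [h]
      simp only [Pi.sub_apply] at h1 ⊢
      omega
    · have := heff q
      simp only [Pi.sub_apply, Pi.single_eq_same] at this ⊢
      omega
  let T : Set (Fin 4 × Fin 4 → ℤ) := {f | Effective (D - lap (rook 4 4) f)}
  have hT : T.Nonempty := by
    obtain ⟨f, hf, -⟩ := hreach (0, 0)
    exact ⟨f, hf⟩
  let Φ : (Fin 4 × Fin 4 → ℤ) → ℕ := fun f => (∑ v, (D - lap (rook 4 4) f) v ^ 2).toNat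
  obtain ⟨g, hg, hmin⟩ := WellFounded.has_min (measure Φ).wf T hT
  have hgdeg : degD (D - lap (rook 4 4) g) ≤ 11 := by rwa [degD_sub_lap]
  obtain ⟨q, hq0, hq⟩ := exists_zero_not_legal hg hgdeg
  obtain ⟨f, hf, hfq⟩ := hreach q
  have hfg : D - lap (rook 4 4) f =
      (D - lap (rook 4 4) g) - lap (rook 4 4) (f - g) := by
    rw [lap_sub]
    abel
  rw [hfg] at hf hfq
  refine absurd (sub_lap_apply_nonpos_of_reduced (rook 4 4) hq0 ?_ hf) (by omega)
  intro A hA hqA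
  by_contra! hlegal
  have hcut : cutSize (rook 4 4) A ≤ 11 := by
    rw [cutSize_eq_sum_edgesTo]
    have h1 := (Finset.sum_le_sum hlegal).trans (Effective.le_degD hg A)
    have := h1.trans hgdeg
    exact_mod_cast this
  rcases smallClique_of_cutSize_le hcut with h | h
  · have hlt := sum_sq_sub_lap_lt_of_smallClique hg hgdeg h hA hlegal
    have heq : D - lap (rook 4 4) g - lap (rook 4 4) (ind A) =
        D - lap (rook 4 4) (g + ind A) := by rw [lap_add, sub_sub]
    have heff : g + ind A ∈ T := by
      intro v
      rw [← heq, ← fire_eq_sub_lap]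
      unfold fire
      split_ifs with hv
      · have := hlegal v hv
        omega
      · have := hg v
        omega
    rw [heq] at hlt
    refine hmin _ heff ?_
    have h0 : 0 ≤ ∑ u, (D - lap (rook 4 4) (g + ind A)) u ^ 2 :=
      Finset.sum_nonneg fun u _ => sq_nonneg _
    change (∑ v, (D - lap (rook 4 4) (g + ind A)) v ^ 2).toNat <
      (∑ v, (D - lap (rook 4 4) g) v ^ 2).toNat
    omega
  · obtain ⟨v, hv, hlt⟩ := hq Aᶜ (Finset.mem_compl.2 hqA) h.1
    exact absurd (hlegal v (by simpa using hv)) hlt.not_ge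

/-- The divisor with one chip on each vertex of the first three columns has positive rank. -/
theorem rankGE_one_three_columns :
    RankGE (rook 4 4) (ind (Finset.univ.filter fun v => v.2 ≠ 3)) 1 := by
  intro E hE hdeg
  obtain ⟨q, rfl⟩ := hE.eq_single (by simpa using hdeg)
  by_cases hq : q.2 = 3
  · refine ⟨_, Relation.ReflTransGen.single ⟨Finset.univ.filter fun v => v.2 ≠ 3, rfl⟩, ?_⟩
    have : ∀ q : Fin 4 × Fin 4, q.2 = 3 → ∀ v, 0 ≤ fire (rook 4 4)
        (ind (Finset.univ.filter fun v : Fin 4 × Fin 4 => v.2 ≠ 3) - Pi.single q 1)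
        (Finset.univ.filter fun v => v.2 ≠ 3) v := by decide +kernel
    exact this q hq
  · refine ⟨_, Relation.ReflTransGen.refl, ?_⟩
    have : ∀ q : Fin 4 × Fin 4, q.2 ≠ 3 → ∀ v, 0 ≤
        (ind (Finset.univ.filter fun v : Fin 4 × Fin 4 => v.2 ≠ 3) - Pi.single q 1 :
          Fin 4 × Fin 4 → ℤ) v := by decide +kernel
    exact this q hq

theorem gonality_rook : gonality (rook 4 4) = 12 := by
  have hmem : 12 ∈ {d : ℕ | ∃ D : Fin 4 × Fin 4 → ℤ, RankGE (rook 4 4) D 1 ∧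
      degD D = (d : ℤ)} :=
    ⟨_, rankGE_one_three_columns, by unfold degD; decide +kernel⟩
  refine le_antisymm (Nat.sInf_le hmem) (le_csInf ⟨12, hmem⟩ ?_)
  rintro d ⟨D, hD, hdeg⟩
  by_contra! hlt
  exact not_rankGE_one_of_degD_le (by omega) hD

end Gonality

/-- The scramble number of `K_4 □ K_4` is `11`, strictly smaller than its gonality,
which is `12`. -/
theorem sn_rook_four_four :
    scrambleNumber (rook 4 4) = (11 : ℕ∞) ∧
    gonality (rook 4 4) = 12 ∧
    scrambleNumber (rook 4 4) < (gonality (rook 4 4) : ℕ∞) := by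
  rw [scrambleNumber_rook, gonality_rook]
  exact ⟨rfl, rfl, by norm_num⟩
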